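/- Let N be a nonnegative integer-valued random variable with P(N ≥ 2) > 0 and E[N²] < ∞, let φ(x) = E[x^N], b = E[N] > 1, and let 0 < α ≤ 1 with α b > 1. Let β ∈ [0,1) satisfy β = φ(αβ + 1 − α), set x_0 = αβ + 1 − α, define ω(x) = (α b − 1)/( α φ(x) − x + 1 − α ) + 1/(1 − x) on (x_0, 1) extended continuously at 1, and Ω(x) = exp( ∫_1^x ω(τ) dτ ). Suppose u : (0,∞) → (x_0, 1) is differentiable, satisfies the differential equation (α b − 1) u'(t) = (1/t)( α φ(u(t)) − u(t) + 1 − α ) for all t > 0, and satisfies lim_{t→0⁺} u(t) = 1 and lim_{t→0⁺} (1 − u(t))/t = 1/b. Then b (1 − u(t)) Ω(u(t)) = t for every t > 0. -/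

import Mathlib

open MeasureTheory ProbabilityTheory Set Filter

noncomputable section

/-- A power of a point of `[0, 1]` with random exponent is integrable. -/
lemma integrable_pow_of_mem_Icc {Ω : Type*} [MeasurableSpace Ω] {μ : Measure Ω}
    [IsFiniteMeasure μ] {N : Ω → ℕ} (hN : Measurable N) {x : ℝ} (hx : x ∈ Icc (0 : ℝ) 1) :
    Integrable (fun ω => x ^ N ω) μ := by
  refine Integrable.of_bound
    ((measurable_from_nat (f := fun n : ℕ => x ^ n)).comp hN).aestronglyMeasurable 1
    (Eventually.of_forall fun ω => ?_)
  rw [Real.norm_of_nonneg (pow_nonneg hx.1 _)]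
  exact pow_le_one₀ hx.1 hx.2

/-- The generating function of an `ℕ`-valued random variable is continuous on `[0, 1]`. -/
lemma continuousOn_integral_pow {Ω : Type*} [MeasurableSpace Ω] {μ : Measure Ω}
    [IsFiniteMeasure μ] {N : Ω → ℕ} (hN : Measurable N) :
    ContinuousOn (fun x : ℝ => ∫ ω, x ^ N ω ∂μ) (Icc 0 1) := by
  refine continuousOn_of_dominated (bound := fun _ => 1)
    (fun x hx => (integrable_pow_of_mem_Icc hN hx).aestronglyMeasurable)
    (fun x hx => Eventually.of_forall fun ω => ?_) (integrable_const _)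
    (Eventually.of_forall fun ω => (continuous_pow (N ω)).continuousOn)
  rw [Real.norm_of_nonneg (pow_nonneg hx.1 _)]
  exact pow_le_one₀ hx.1 hx.2

/-- The generating function of a random variable that exceeds `1` with positive probability is
strictly convex on `[0, 1]`. -/
lemma strictConvexOn_integral_pow {Ω : Type*} [MeasurableSpace Ω] {μ : Measure Ω}
    [IsFiniteMeasure μ] {N : Ω → ℕ} (hN : Measurable N) (h2 : 0 < μ {ω | 2 ≤ N ω}) :
    StrictConvexOn ℝ (Icc (0 : ℝ) 1) (fun x => ∫ ω, x ^ N ω ∂μ) := by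
  refine ⟨convex_Icc 0 1, fun x hx y hy hxy a c ha hc hac => ?_⟩
  have hz : a • x + c • y ∈ Icc (0 : ℝ) 1 := convex_Icc 0 1 hx hy ha.le hc.le hac
  have ix := (integrable_pow_of_mem_Icc (μ := μ) hN hx).const_mul a
  have iy := (integrable_pow_of_mem_Icc (μ := μ) hN hy).const_mul c
  have iz := integrable_pow_of_mem_Icc (μ := μ) hN hz
  have ixy : Integrable (fun ω => a * x ^ N ω + c * y ^ N ω) μ := ix.add iy
  have hpos : 0 < ∫ ω, (a * x ^ N ω + c * y ^ N ω - (a • x + c • y) ^ N ω) ∂μ := by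
    refine (integral_pos_iff_support_of_nonneg ?_ (ixy.sub iz)).2 ?_
    rotate_left
    · refine h2.trans_le (measure_mono fun ω hω => ?_)
      have := (strictConvexOn_pow hω).2 hx.1 hy.1 hxy ha hc hac
      simp only [smul_eq_mul] at this
      exact (sub_pos.2 this).ne'
    · intro ω
      have := (convexOn_pow (N ω)).2 hx.1 hy.1 ha.le hc.le hac
      simp only [smul_eq_mul] at this
      exact sub_nonneg.2 this
  rw [integral_sub ixy iz, integral_add ix iy, integral_const_mul, integral_const_mul] at hpos
  simpa only [smul_eq_mul] using sub_pos.1 hpos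

/-- A solution `u` of the differential equation
`(αb - 1) u'(t) = (1/t)(αφ(u(t)) - u(t) + 1 - α)` on `(0,∞)` with values in
`(x₀, 1)`, satisfying `u(t) → 1` and `(1 - u(t))/t → 1/b` as `t → 0⁺`, satisfies
the implicit equation `b (1 - u(t)) Ω(u(t)) = t` for all `t > 0`. -/
theorem solution_implicit_equation
    {Ω : Type*} [MeasureSpace Ω] [IsProbabilityMeasure (ℙ : Measure Ω)]
    (N : Ω → ℕ) (hNmeas : Measurable N)
    (hN2pos : 0 < ℙ {ω | 2 ≤ N ω})
    (hN2 : Integrable (fun ω => (N ω : ℝ) ^ 2))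
    (φ : ℝ → ℝ) (hφ : ∀ x, φ x = ∫ ω, x ^ (N ω))
    (b : ℝ) (hb : b = ∫ ω, (N ω : ℝ)) (hb1 : 1 < b)
    (α : ℝ) (hα0 : 0 < α) (hα1 : α ≤ 1) (hαb : 1 < α * b)
    (β : ℝ) (hβ : β ∈ Ico (0 : ℝ) 1) (hβfix : β = φ (α * β + 1 - α))
    (x₀ : ℝ) (hx₀ : x₀ = α * β + 1 - α)
    (ω' : ℝ → ℝ)
    (hω' : ∀ x ∈ Ioo x₀ 1, ω' x = (α * b - 1) / (α * φ x - x + 1 - α) + 1 / (1 - x))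
    (hω'cont : ContinuousWithinAt ω' (Iio 1) 1)
    (Ω' : ℝ → ℝ) (hΩ' : ∀ x, Ω' x = Real.exp (∫ τ in (1 : ℝ)..x, ω' τ))
    (u : ℝ → ℝ)
    (hurange : ∀ t > (0 : ℝ), u t ∈ Ioo x₀ 1)
    (hudiff : ∀ t > (0 : ℝ), DifferentiableAt ℝ u t)
    (hode : ∀ t > (0 : ℝ),
      (α * b - 1) * deriv u t = (1 / t) * (α * φ (u t) - u t + 1 - α))
    (hlim1 : Tendsto u (nhdsWithin 0 (Ioi 0)) (nhds 1))
    (hlim2 : Tendsto (fun t => (1 - u t) / t) (nhdsWithin 0 (Ioi 0)) (nhds (1 / b))) :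
    ∀ t > (0 : ℝ), b * (1 - u t) * Ω' (u t) = t := by
  have hk : 0 < α * b - 1 := sub_pos.2 hαb
  have hφeq : φ = fun x => ∫ ω, x ^ N ω := funext hφ
  have hx₀nn : 0 ≤ x₀ := by nlinarith [mul_nonneg hα0.le hβ.1]
  have hx₀lt : x₀ < 1 := by nlinarith [hβ.2]
  have hφ1 : φ 1 = 1 := by simp [hφ]
  have hφx₀ : φ x₀ = β := by rw [hx₀, ← hβfix]
  have hFneg : ∀ x ∈ Ioo x₀ 1, α * φ x - x + 1 - α < 0 := by
    rintro x ⟨hx0, hx1⟩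
    have h := (strictConvexOn_integral_pow hNmeas hN2pos).secant_strict_mono
      ⟨hx₀nn, hx₀lt.le⟩
      ⟨hx₀nn.trans hx0.le, hx1.le⟩ ⟨zero_le_one, le_rfl⟩ hx0.ne' hx₀lt.ne' hx1
    simp only [← hφ] at h
    rw [hφ1, hφx₀, div_lt_div_iff₀ (by linarith) (by linarith)] at h
    have h1 : 1 - x₀ = α * (1 - β) := by rw [hx₀]; ring
    rw [h1] at h
    have hβ1 : 0 < 1 - β := sub_pos.2 hβ.2
    have h3 : (φ x - β) * α < x - x₀ := by nlinarith
    rw [hx₀] at h3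
    linarith
  have hφcont : ContinuousOn φ (Ioo x₀ 1) := by
    rw [hφeq]
    exact (continuousOn_integral_pow hNmeas).mono fun x hx => ⟨hx₀nn.trans hx.1.le, hx.2.le⟩
  have hωIoo : ContinuousOn ω' (Ioo x₀ 1) := by
    refine ContinuousOn.congr ?_ hω'
    refine (continuousOn_const.div (by fun_prop) fun x hx => (hFneg x hx).ne).add
      (continuousOn_const.div (by fun_prop) fun x hx => (sub_pos.2 hx.2).ne')
  have hωIoc : ContinuousOn ω' (Ioc x₀ 1) := by
    intro x hx
    rcases hx.2.eq_or_lt with rfl | hx1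
    · refine ((continuousWithinAt_insert_self.2 hω'cont).mono ?_)
      rw [Iio_insert]
      exact Ioc_subset_Iic_self
    · exact (hωIoo.continuousAt (Ioo_mem_nhds hx.1 hx1)).continuousWithinAt
  set w : ℝ → ℝ := fun x => ω' (min x 1) with hw
  have hwcont : ContinuousOn w (Ioi x₀) :=
    hωIoc.comp (by fun_prop) fun x hx => ⟨lt_min hx hx₀lt, min_le_right _ _⟩
  set G : ℝ → ℝ := fun x => ∫ τ in (1 : ℝ)..x, w τ with hG
  have hGderiv : ∀ x ∈ Ioi x₀, HasDerivAt G (w x) x := fun x hx =>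
    intervalIntegral.integral_hasDerivAt_right
      (hwcont.mono fun y hy => (lt_min hx₀lt hx).trans_le hy.1).intervalIntegrable
      (hwcont.stronglyMeasurableAtFilter isOpen_Ioi x hx)
      (hwcont.continuousAt (Ioi_mem_nhds hx))
  have hΩG : ∀ x ∈ Ioo x₀ 1, Ω' x = Real.exp (G x) := by
    intro x hx
    rw [hΩ', hG]
    congr 1
    refine intervalIntegral.integral_congr fun y hy => ?_
    rw [uIcc_of_ge hx.2.le] at hy
    simp [hw, min_eq_left hy.2]
  set K : ℝ → ℝ := fun t => (1 - u t) / t * Real.exp (G (u t)) with hK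
  have hKderiv : ∀ t ∈ Ioi (0 : ℝ), HasDerivAt K 0 t := by
    intro t ht
    have ht0 : t ≠ 0 := ne_of_gt ht
    have hu := hurange t ht
    have hdu := (hudiff t ht).hasDerivAt
    have hF := (hFneg _ hu).ne
    have h1u : 1 - u t ≠ 0 := (sub_pos.2 hu.2).ne'
    have hd := ((hdu.const_sub 1).div (hasDerivAt_id t) ht0).mul
      ((hGderiv (u t) hu.1).comp t hdu).exp
    refine hd.congr_deriv ?_
    have hwu : w (u t) = (α * b - 1) / (α * φ (u t) - u t + 1 - α) + 1 / (1 - u t) := by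
      rw [← hω' _ hu, hw]
      simp [min_eq_left hu.2.le]
    have hdu' : deriv u t = (α * φ (u t) - u t + 1 - α) / (t * (α * b - 1)) := by
      rw [eq_div_iff (mul_ne_zero ht0 hk.ne')]
      have := hode t ht
      field_simp at this
      linarith
    have hkey : w (u t) * deriv u t = 1 / t + deriv u t / (1 - u t) := by
      rw [hwu, add_mul]
      congr 1
      · rw [hdu']
        field_simp [hk.ne']
      · ring
    simp only [Function.comp_apply, id, hkey, Pi.div_apply]
    field_simp
    ring
  have hGlim : Tendsto (fun t => G (u t)) (nhdsWithin 0 (Ioi 0)) (nhds 0) := by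
    have h := (hGderiv 1 hx₀lt).continuousAt.tendsto.comp hlim1
    simpa [hG, Function.comp_def] using h
  have hKlim : Tendsto K (nhdsWithin 0 (Ioi 0)) (nhds (1 / b)) := by
    simpa using hlim2.mul ((Real.continuous_exp.tendsto 0).comp hGlim)
  intro t ht
  have hKconst : ∀ s ∈ Ioi (0 : ℝ), K s = K t := fun s hs =>
    isOpen_Ioi.is_const_of_deriv_eq_zero isPreconnected_Ioi
      (fun y hy => (hKderiv y hy).differentiableAt.differentiableWithinAt)
      (fun y hy => (hKderiv y hy).deriv) hs ht
  have hKt : K t = 1 / b := tendsto_nhds_unique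
    (tendsto_const_nhds.congr' (eventually_nhdsWithin_of_forall fun s hs => (hKconst s hs).symm))
    hKlim
  rw [hΩG _ (hurange t ht)]
  have hb0 : b ≠ 0 := by linarith
  simp only [hK] at hKt
  field_simp at hKt
  linarith

end
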